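/- Let d ≥ 1 be an integer, let σ̃ ≥ 2/d and λ ≥ 0 be real numbers, and let T > 0. Let u : ℝ × ℝ^d → ℂ be infinitely differentiable, such that for every multi-index α, every j ∈ {0,1} and every k ∈ ℕ, sup_{t∈[0,T], x∈ℝ^d} (1+|x|)^k |∂_t^j ∂_x^α u(t,x)| < ∞, and such that i ∂_t u(t,x) = Δ_x u(t,x) + λ |u(t,x)|^{2σ̃} u(t,x) for all (t,x) ∈ [0,T] × ℝ^d. Then for every t ∈ [0,T], V(u(t,·)) ≤ V(u(0,·)) + 4 t G(u(0,·)) + 8 t² H_{σ̃,λ}(u(0,·)). -/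

import Mathlib

open MeasureTheory Complex Filter Topology

noncomputable section

variable {d : ℕ}

/-- The `k`-th partial derivative of a function `u : ℝ^d → ℂ`. -/
def pd (u : EuclideanSpace ℝ (Fin d) → ℂ) (k : Fin d) (x : EuclideanSpace ℝ (Fin d)) : ℂ :=
  fderiv ℝ u x (EuclideanSpace.single k 1)

/-- The second partial derivative `∂_j ∂_k u` of a function `u : ℝ^d → ℂ`. -/
def pd2 (u : EuclideanSpace ℝ (Fin d) → ℂ) (j k : Fin d) (x : EuclideanSpace ℝ (Fin d)) : ℂ :=
  fderiv ℝ (fun y => fderiv ℝ u y (EuclideanSpace.single k 1)) x (EuclideanSpace.single j 1)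

/-- The Laplacian of a function `u : ℝ^d → ℂ`. -/
def lap (u : EuclideanSpace ℝ (Fin d) → ℂ) (x : EuclideanSpace ℝ (Fin d)) : ℂ :=
  ∑ k, pd2 u k k x

/-- The mass `M(v) = ∫ |v|² dx`. -/
def massM (v : EuclideanSpace ℝ (Fin d) → ℂ) : ℝ := ∫ x, ‖v x‖ ^ 2

/-- The energy `H_{σ̃,λ}(v) = (1/2) ∫ |∇v|² dx − (λ/(2σ̃+2)) ∫ |v|^{2σ̃+2} dx`. -/
def energyH (σt lam : ℝ) (v : EuclideanSpace ℝ (Fin d) → ℂ) : ℝ :=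
  (1 / 2) * (∫ x, ∑ k, ‖pd v k x‖ ^ 2)
    - (lam / (2 * σt + 2)) * ∫ x, ‖v x‖ ^ (2 * σt + 2)

/-- The variance `V(v) = ∫ |x|² |v(x)|² dx`. -/
def varV (v : EuclideanSpace ℝ (Fin d) → ℂ) : ℝ := ∫ x, ‖x‖ ^ 2 * ‖v x‖ ^ 2

/-- The momentum `G(v) = Im ∫ v (x·∇v̄) dx`. -/
def momG (v : EuclideanSpace ℝ (Fin d) → ℂ) : ℝ :=
  (∫ x, v x * ∑ k, (x k : ℂ) * (starRingEnd ℂ) (pd v k x)).im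

/-- `u`, together with its first time derivative, is rapidly decreasing in space,
uniformly on the time interval `[0, T]`: for every spatial multi-index (encoded via
the order `n` of the iterated spatial derivative), every `j ∈ {0,1}` and every `k`,
`sup_{t∈[0,T], x} (1+|x|)^k |∂_t^j ∂_x^α u(t,x)| < ∞`. -/
def RapidlyDecreasingOn (T : ℝ) (u : ℝ × EuclideanSpace ℝ (Fin d) → ℂ) : Prop :=
  ∀ n k : ℕ, ∃ C : ℝ, ∀ t ∈ Set.Icc (0 : ℝ) T, ∀ x,
    (1 + ‖x‖) ^ k * ‖iteratedFDeriv ℝ n (fun y => u (t, y)) x‖ ≤ C ∧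
    (1 + ‖x‖) ^ k * ‖iteratedFDeriv ℝ n (fun y => deriv (fun s => u (s, y)) t) x‖ ≤ C

/-- `u` is a classical solution on `[0, T]` of the nonlinear Schrödinger equation
`i ∂_t u = Δu + λ |u|^{2σ̃} u`. -/
def IsNLSSolution (σt lam T : ℝ) (u : ℝ × EuclideanSpace ℝ (Fin d) → ℂ) : Prop :=
  ∀ t ∈ Set.Icc (0 : ℝ) T, ∀ x,
    Complex.I * deriv (fun s => u (s, x)) t
      = lap (fun y => u (t, y)) x
        + ((lam * ‖u (t, x)‖ ^ (2 * σt) : ℝ) : ℂ) * u (t, x)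

/-- A continuous function on `ℝ × ℝ^d` which decays faster than every power of `1 + ‖x‖`,
uniformly for times in `[0, T]`. -/
structure RapidDecay {F : Type*} [NormedAddCommGroup F] (T : ℝ)
    (f : ℝ × EuclideanSpace ℝ (Fin d) → F) : Prop where
  continuous : Continuous f
  decay : ∀ k : ℕ, ∃ C : ℝ, ∀ t ∈ Set.Icc (0 : ℝ) T, ∀ x, (1 + ‖x‖) ^ k * ‖f (t, x)‖ ≤ C

namespace RapidDecay

variable {F : Type*} [NormedAddCommGroup F] {T : ℝ}

theorem add {f g : ℝ × EuclideanSpace ℝ (Fin d) → F} (hf : RapidDecay T f)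
    (hg : RapidDecay T g) : RapidDecay T (fun z => f z + g z) := by
  refine ⟨hf.continuous.add hg.continuous, fun k => ?_⟩
  obtain ⟨C, hC⟩ := hf.decay k
  obtain ⟨C', hC'⟩ := hg.decay k
  refine ⟨C + C', fun t ht x => ?_⟩
  calc (1 + ‖x‖) ^ k * ‖f (t, x) + g (t, x)‖
      ≤ (1 + ‖x‖) ^ k * (‖f (t, x)‖ + ‖g (t, x)‖) := by gcongr; exact norm_add_le _ _
    _ ≤ C + C' := by rw [mul_add]; exact add_le_add (hC t ht x) (hC' t ht x)

theorem neg {f : ℝ × EuclideanSpace ℝ (Fin d) → F} (hf : RapidDecay T f) :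
    RapidDecay T (fun z => -f z) :=
  ⟨hf.continuous.neg, by simpa only [norm_neg] using hf.decay⟩

theorem sub {f g : ℝ × EuclideanSpace ℝ (Fin d) → F} (hf : RapidDecay T f)
    (hg : RapidDecay T g) : RapidDecay T (fun z => f z - g z) := by
  simpa only [sub_eq_add_neg] using hf.add hg.neg

theorem zero : RapidDecay T (fun _ : ℝ × EuclideanSpace ℝ (Fin d) => (0 : F)) :=
  ⟨continuous_const, fun _ => ⟨0, by simp⟩⟩

theorem sum {ι : Type*} {s : Finset ι} {f : ι → ℝ × EuclideanSpace ℝ (Fin d) → F}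
    (hf : ∀ i, RapidDecay T (f i)) : RapidDecay T (fun z => ∑ i ∈ s, f i z) := by
  classical
  induction s using Finset.induction_on with
  | empty => simpa using zero
  | insert i s hi ih => simpa only [Finset.sum_insert hi] using (hf i).add ih

theorem of_norm_le {G : Type*} [NormedAddCommGroup G]
    {f : ℝ × EuclideanSpace ℝ (Fin d) → F} {g : ℝ × EuclideanSpace ℝ (Fin d) → G}
    (hf : RapidDecay T f) (hg : Continuous g) (n : ℕ) (K : ℝ)
    (h : ∀ t ∈ Set.Icc (0 : ℝ) T, ∀ x, ‖g (t, x)‖ ≤ K * (1 + ‖x‖) ^ n * ‖f (t, x)‖) :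
    RapidDecay T g := by
  refine ⟨hg, fun k => ?_⟩
  obtain ⟨C, hC⟩ := hf.decay (k + n)
  refine ⟨|K| * C, fun t ht x => ?_⟩
  calc (1 + ‖x‖) ^ k * ‖g (t, x)‖
      ≤ (1 + ‖x‖) ^ k * (K * (1 + ‖x‖) ^ n * ‖f (t, x)‖) := by gcongr; exact h t ht x
    _ = K * ((1 + ‖x‖) ^ (k + n) * ‖f (t, x)‖) := by ring
    _ ≤ |K| * ((1 + ‖x‖) ^ (k + n) * ‖f (t, x)‖) := by gcongr; exact le_abs_self K
    _ ≤ |K| * C := by gcongr; exact hC t ht x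

theorem bounded {f : ℝ × EuclideanSpace ℝ (Fin d) → F} (hf : RapidDecay T f) :
    ∃ C : ℝ, ∀ t ∈ Set.Icc (0 : ℝ) T, ∀ x, ‖f (t, x)‖ ≤ C := by
  simpa using hf.decay 0

theorem bounded_mul {A : Type*} [NormedRing A] {w f : ℝ × EuclideanSpace ℝ (Fin d) → A}
    (hw : Continuous w) (hwb : ∃ C : ℝ, ∀ t ∈ Set.Icc (0 : ℝ) T, ∀ x, ‖w (t, x)‖ ≤ C)
    (hf : RapidDecay T f) : RapidDecay T (fun z => w z * f z) := by
  obtain ⟨C, hC⟩ := hwb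
  refine hf.of_norm_le (hw.mul hf.continuous) 0 C fun t ht x => ?_
  rw [pow_zero, mul_one]
  exact (norm_mul_le _ _).trans (by gcongr; exact hC t ht x)

theorem mul {A : Type*} [NormedRing A] {f g : ℝ × EuclideanSpace ℝ (Fin d) → A}
    (hf : RapidDecay T f) (hg : RapidDecay T g) : RapidDecay T (fun z => f z * g z) :=
  bounded_mul hf.continuous hf.bounded hg

theorem const_mul {A : Type*} [NormedRing A] {f : ℝ × EuclideanSpace ℝ (Fin d) → A} (c : A)
    (hf : RapidDecay T f) : RapidDecay T (fun z => c * f z) :=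
  bounded_mul continuous_const ⟨‖c‖, fun _ _ _ => le_rfl⟩ hf

theorem coord_mul {f : ℝ × EuclideanSpace ℝ (Fin d) → ℝ} (k : Fin d) (hf : RapidDecay T f) :
    RapidDecay T (fun z => z.2 k * f z) := by
  have hc : Continuous fun z : ℝ × EuclideanSpace ℝ (Fin d) => z.2 k := by fun_prop
  refine hf.of_norm_le (hc.mul hf.continuous) 1 1 fun t _ x => ?_
  rw [norm_mul, one_mul, pow_one]
  gcongr
  exact (PiLp.norm_apply_le x k).trans (by simp)

theorem norm_sq_mul {f : ℝ × EuclideanSpace ℝ (Fin d) → ℝ} (hf : RapidDecay T f) :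
    RapidDecay T (fun z => ‖z.2‖ ^ 2 * f z) := by
  refine hf.of_norm_le (by have := hf.continuous; fun_prop) 2 1 fun t _ x => ?_
  rw [norm_mul, one_mul, norm_pow, norm_norm]
  gcongr
  simp

theorem clm_comp [NormedSpace ℝ F] {G : Type*} [NormedAddCommGroup G] [NormedSpace ℝ G]
    {f : ℝ × EuclideanSpace ℝ (Fin d) → F} (L : F →L[ℝ] G) (hf : RapidDecay T f) :
    RapidDecay T (fun z => L (f z)) := by
  refine hf.of_norm_le (L.continuous.comp hf.continuous) 0 ‖L‖ fun t _ x => ?_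
  rw [pow_zero, mul_one]
  exact L.le_opNorm _

theorem exists_integrable_bound {f : ℝ × EuclideanSpace ℝ (Fin d) → F} (hf : RapidDecay T f) :
    ∃ g : EuclideanSpace ℝ (Fin d) → ℝ, Integrable g ∧
      ∀ t ∈ Set.Icc (0 : ℝ) T, ∀ x, ‖f (t, x)‖ ≤ g x := by
  obtain ⟨C, hC⟩ := hf.decay (d + 1)
  refine ⟨fun x => C * (1 + ‖x‖) ^ (-((d + 1 : ℕ) : ℝ)),
    (integrable_one_add_norm (by simp)).const_mul C, fun t ht x => ?_⟩
  have hx : 0 < 1 + ‖x‖ := by positivity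
  beta_reduce
  rw [Real.rpow_neg hx.le, Real.rpow_natCast, ← div_eq_mul_inv, le_div_iff₀ (by positivity),
    mul_comm]
  exact hC t ht x

theorem integrable {f : ℝ × EuclideanSpace ℝ (Fin d) → F} (hf : RapidDecay T f) {t : ℝ}
    (ht : t ∈ Set.Icc (0 : ℝ) T) : Integrable fun x => f (t, x) := by
  obtain ⟨g, hg, hfg⟩ := hf.exists_integrable_bound
  exact hg.mono' (by have := hf.continuous; fun_prop) (.of_forall (hfg t ht))

theorem continuousOn_integral [NormedSpace ℝ F] {f : ℝ × EuclideanSpace ℝ (Fin d) → F}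
    (hf : RapidDecay T f) : ContinuousOn (fun t => ∫ x, f (t, x)) (Set.Icc 0 T) := by
  obtain ⟨g, hg, hfg⟩ := hf.exists_integrable_bound
  have hc := hf.continuous
  refine continuousOn_of_dominated (fun t _ => ?_) (fun t ht => .of_forall (hfg t ht)) hg
    (.of_forall fun x => ?_)
  · exact Continuous.aestronglyMeasurable (by fun_prop)
  · exact Continuous.continuousOn (by fun_prop)

end RapidDecay

theorem integral_eq_zero_of_hasLineDerivAt {f f' : EuclideanSpace ℝ (Fin d) → ℝ}
    {v : EuclideanSpace ℝ (Fin d)} (hf : Integrable f) (hf' : Integrable f')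
    (h : ∀ x, HasLineDerivAt ℝ f (f' x) x v) : ∫ x, f' x = 0 := by
  have := integral_bilinear_hasLineDerivAt_right_eq_neg_left_of_integrable
    (μ := (volume : Measure (EuclideanSpace ℝ (Fin d)))) (f := fun _ => (1 : ℝ))
    (f' := fun _ => (0 : ℝ)) (g := f) (g' := f') (v := v) (B := ContinuousLinearMap.mul ℝ ℝ)
    (by simp) (by simpa using hf') (by simpa using hf)
    (fun x _ => by simpa [HasLineDerivAt] using hasDerivAt_const (0 : ℝ) (1 : ℝ)) (fun x _ => h x)
  simpa using this

/-- The unit time direction in `ℝ × ℝ^d`. -/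
abbrev timeDir : ℝ × EuclideanSpace ℝ (Fin d) := (1, 0)

/-- The `k`-th unit space direction in `ℝ × ℝ^d`. -/
abbrev spaceDir (k : Fin d) : ℝ × EuclideanSpace ℝ (Fin d) := (0, EuclideanSpace.single k 1)

theorem HasLineDerivAt.slice_space {f : ℝ × EuclideanSpace ℝ (Fin d) → ℝ} {f' t : ℝ}
    {x : EuclideanSpace ℝ (Fin d)} {k : Fin d} (h : HasLineDerivAt ℝ f f' (t, x) (spaceDir k)) :
    HasLineDerivAt ℝ (fun y => f (t, y)) f' x (EuclideanSpace.single k 1) := by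
  simpa [HasLineDerivAt] using h

theorem HasLineDerivAt.slice_time {f : ℝ × EuclideanSpace ℝ (Fin d) → ℝ} {f' t : ℝ}
    {x : EuclideanSpace ℝ (Fin d)} (h : HasLineDerivAt ℝ f f' (t, x) timeDir) :
    HasDerivAt (fun s => f (s, x)) f' t := by
  have h1 : HasDerivAt (fun s => f (t + s, x)) f' (t - t) := by
    simpa [HasLineDerivAt] using h
  simpa using h1.comp_sub_const t t

/-- A local balance law `∂_t e = r + ∑ k, ∂_k J_k` for rapidly decreasing quantities
integrates to `d/dt ∫ e = ∫ r`. -/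
theorem RapidDecay.hasDerivAt_integral_of_balance {T : ℝ}
    {e e' r : ℝ × EuclideanSpace ℝ (Fin d) → ℝ} {J J' : Fin d → ℝ × EuclideanSpace ℝ (Fin d) → ℝ}
    (he : RapidDecay T e) (he' : RapidDecay T e') (hr : RapidDecay T r)
    (hJ : ∀ k, RapidDecay T (J k)) (hJ' : ∀ k, RapidDecay T (J' k))
    (hde : ∀ z, HasLineDerivAt ℝ e (e' z) z timeDir)
    (hdJ : ∀ k z, HasLineDerivAt ℝ (J k) (J' k z) z (spaceDir k))
    (hbal : ∀ t ∈ Set.Icc (0 : ℝ) T, ∀ x, e' (t, x) = r (t, x) + ∑ k, J' k (t, x))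
    {t : ℝ} (ht : t ∈ Set.Ioo (0 : ℝ) T) :
    HasDerivAt (fun s => ∫ x, e (s, x)) (∫ x, r (t, x)) t := by
  have ht' := Set.Ioo_subset_Icc_self ht
  obtain ⟨g, hg, heg⟩ := he'.exists_integrable_bound
  have hc := he.continuous
  have h := (hasDerivAt_integral_of_dominated_loc_of_deriv_le (μ := volume) (x₀ := t)
    (F := fun s x => e (s, x)) (F' := fun s x => e' (s, x)) (Ioo_mem_nhds ht.1 ht.2)
    (.of_forall fun s => Continuous.aestronglyMeasurable (by fun_prop))
    (he.integrable ht') (he'.integrable ht').aestronglyMeasurable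
    (.of_forall fun x s hs => heg s (Set.Ioo_subset_Icc_self hs) x) hg
    (.of_forall fun x s _ => (hde (s, x)).slice_time)).2
  have hint : ∫ x, e' (t, x) = ∫ x, r (t, x) := by
    simp_rw [hbal t ht']
    rw [integral_add (hr.integrable ht') (integrable_finsetSum _ fun k _ => (hJ' k).integrable ht'),
      integral_finsetSum _ fun k _ => (hJ' k).integrable ht']
    simp [fun k => integral_eq_zero_of_hasLineDerivAt ((hJ k).integrable ht')
      ((hJ' k).integrable ht') fun x => (hdJ k (t, x)).slice_space]
  rwa [hint] at h

namespace HasLineDerivAt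

variable {V : Type*} [AddCommGroup V] [Module ℝ V] {f g : V → ℝ} {f' g' : ℝ} {x v : V}

theorem fun_add (hf : HasLineDerivAt ℝ f f' x v) (hg : HasLineDerivAt ℝ g g' x v) :
    HasLineDerivAt ℝ (fun y => f y + g y) (f' + g') x v :=
  HasDerivAt.add hf hg

theorem fun_sub (hf : HasLineDerivAt ℝ f f' x v) (hg : HasLineDerivAt ℝ g g' x v) :
    HasLineDerivAt ℝ (fun y => f y - g y) (f' - g') x v :=
  HasDerivAt.sub hf hg

theorem fun_const_mul (c : ℝ) (hf : HasLineDerivAt ℝ f f' x v) :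
    HasLineDerivAt ℝ (fun y => c * f y) (c * f') x v :=
  HasDerivAt.const_mul c hf

theorem fun_mul (hf : HasLineDerivAt ℝ f f' x v) (hg : HasLineDerivAt ℝ g g' x v) :
    HasLineDerivAt ℝ (fun y => f y * g y) (f' * g x + f x * g') x v := by
  simpa [HasLineDerivAt] using HasDerivAt.fun_mul hf hg

theorem fun_sum {ι : Type*} {s : Finset ι} {f : ι → V → ℝ} {f' : ι → ℝ}
    (hf : ∀ i, HasLineDerivAt ℝ (f i) (f' i) x v) :
    HasLineDerivAt ℝ (fun y => ∑ i ∈ s, f i y) (∑ i ∈ s, f' i) x v :=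
  HasDerivAt.fun_sum fun i _ => hf i

theorem rpow_const {p : ℝ} (hf : HasLineDerivAt ℝ f f' x v) (hp : 1 ≤ p) :
    HasLineDerivAt ℝ (fun y => f y ^ p) (p * (f x ^ (p - 1) * f')) x v := by
  have h := HasDerivAt.rpow_const (p := p) hf (.inr hp)
  have h' : f' * p * f (x + (0 : ℝ) • v) ^ (p - 1) = p * (f x ^ (p - 1) * f') := by
    rw [zero_smul, add_zero]; ring
  exact h' ▸ h

theorem coord (z : ℝ × EuclideanSpace ℝ (Fin d)) (w : ℝ × EuclideanSpace ℝ (Fin d))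
    (k : Fin d) : HasLineDerivAt ℝ (fun y : ℝ × EuclideanSpace ℝ (Fin d) => y.2 k) (w.2 k) z w := by
  have h := ((hasDerivAt_id (0 : ℝ)).mul_const (w.2 k)).const_add (z.2 k)
  simpa [HasLineDerivAt] using h

theorem norm_sq_snd (z w : ℝ × EuclideanSpace ℝ (Fin d)) :
    HasLineDerivAt ℝ (fun y : ℝ × EuclideanSpace ℝ (Fin d) => ‖y.2‖ ^ 2)
      (2 * ∑ k, z.2 k * w.2 k) z w := by
  have h := HasLineDerivAt.fun_sum (s := Finset.univ) fun k => (coord z w k).fun_mul (coord z w k)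
  convert h using 1
  · ext y
    rw [EuclideanSpace.real_norm_sq_eq]
    exact Finset.sum_congr rfl fun k _ => sq _
  · rw [Finset.mul_sum]
    exact Finset.sum_congr rfl fun k _ => by ring

end HasLineDerivAt

/-- The derivative of `f` in the direction `v`. -/
def dirDeriv {V F : Type*} [NormedAddCommGroup V] [NormedSpace ℝ V] [NormedAddCommGroup F]
    [NormedSpace ℝ F] (v : V) (f : V → F) (z : V) : F :=
  fderiv ℝ f z v

section DirDeriv

variable {V F : Type*} [NormedAddCommGroup V] [NormedSpace ℝ V] [NormedAddCommGroup F]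
  [NormedSpace ℝ F] {f : V → F}

theorem ContDiff.dirDeriv (hf : ContDiff ℝ (⊤ : ℕ∞) f) (v : V) :
    ContDiff ℝ (⊤ : ℕ∞) (dirDeriv v f) :=
  (hf.fderiv_right (m := (⊤ : ℕ∞)) (by simp)).clm_apply contDiff_const

theorem ContDiff.hasLineDerivAt_dirDeriv (hf : ContDiff ℝ (⊤ : ℕ∞) f) (v z : V) :
    HasLineDerivAt ℝ f (_root_.dirDeriv v f z) z v :=
  (hf.differentiable (by simp) z).hasFDerivAt.hasLineDerivAt v

theorem ContDiff.dirDeriv_comm (hf : ContDiff ℝ (⊤ : ℕ∞) f) (v w z : V) :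
    _root_.dirDeriv v (_root_.dirDeriv w f) z = _root_.dirDeriv w (_root_.dirDeriv v f) z := by
  have hd : DifferentiableAt ℝ (fderiv ℝ f) z :=
    (hf.fderiv_right (m := (⊤ : ℕ∞)) (by simp)).differentiable (by simp) z
  have h (v w : V) : _root_.dirDeriv v (_root_.dirDeriv w f) z = fderiv ℝ (fderiv ℝ f) z v w := by
    unfold _root_.dirDeriv
    rw [fderiv_clm_apply hd (differentiableAt_const w)]
    simp
  rw [h, h]
  exact (hf.contDiffAt.isSymmSndFDerivAt (by simpa using WithTop.coe_le_coe.2 (le_top : (2 : ℕ∞) ≤ ⊤))) v w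

theorem dirDeriv_clm_comp {G : Type*} [NormedAddCommGroup G] [NormedSpace ℝ G] (L : F →L[ℝ] G)
    (hf : ContDiff ℝ (⊤ : ℕ∞) f) (v : V) :
    dirDeriv v (fun z => L (f z)) = fun z => L (dirDeriv v f z) := by
  ext z
  have h := L.hasFDerivAt.comp z (hf.differentiable (by simp) z).hasFDerivAt
  exact congrArg (fun A => A v) h.fderiv

end DirDeriv

/-- The time derivative of a function on `ℝ × ℝ^d`. -/
abbrev dt {F : Type*} [NormedAddCommGroup F] [NormedSpace ℝ F]
    (f : ℝ × EuclideanSpace ℝ (Fin d) → F) : ℝ × EuclideanSpace ℝ (Fin d) → F :=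
  dirDeriv timeDir f

/-- The `k`-th spatial derivative of a function on `ℝ × ℝ^d`. -/
abbrev dx {F : Type*} [NormedAddCommGroup F] [NormedSpace ℝ F] (k : Fin d)
    (f : ℝ × EuclideanSpace ℝ (Fin d) → F) : ℝ × EuclideanSpace ℝ (Fin d) → F :=
  dirDeriv (spaceDir k) f

/-- A smooth function on `ℝ × ℝ^d` whose derivatives of low order decay rapidly on `[0, T]`. -/
structure RapidJet {F : Type*} [NormedAddCommGroup F] [NormedSpace ℝ F] (T : ℝ)
    (f : ℝ × EuclideanSpace ℝ (Fin d) → F) : Prop where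
  smooth : ContDiff ℝ (⊤ : ℕ∞) f
  self : RapidDecay T f
  dt : RapidDecay T (dt f)
  dx : ∀ k, RapidDecay T (dx k f)
  dx_dx : ∀ j k, RapidDecay T (_root_.dx j (_root_.dx k f))
  dx_dt : ∀ k, RapidDecay T (_root_.dx k (_root_.dt f))

theorem RapidJet.clm_comp {F G : Type*} [NormedAddCommGroup F] [NormedSpace ℝ F]
    [NormedAddCommGroup G] [NormedSpace ℝ G] {T : ℝ} {f : ℝ × EuclideanSpace ℝ (Fin d) → F}
    (hf : RapidJet T f) (L : F →L[ℝ] G) : RapidJet T (fun z => L (f z)) where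
  smooth := L.contDiff.comp hf.smooth
  self := hf.self.clm_comp L
  dt := by rw [_root_.dt, dirDeriv_clm_comp L hf.smooth]; exact hf.dt.clm_comp L
  dx k := by rw [_root_.dx, dirDeriv_clm_comp L hf.smooth]; exact (hf.dx k).clm_comp L
  dx_dx j k := by
    rw [_root_.dx, _root_.dx, dirDeriv_clm_comp L hf.smooth,
      dirDeriv_clm_comp L (hf.smooth.dirDeriv _)]
    exact (hf.dx_dx j k).clm_comp L
  dx_dt k := by
    rw [_root_.dx, _root_.dt, dirDeriv_clm_comp L hf.smooth,
      dirDeriv_clm_comp L (hf.smooth.dirDeriv _)]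
    exact (hf.dx_dt k).clm_comp L

namespace RapidJet

variable {T : ℝ} {f : ℝ × EuclideanSpace ℝ (Fin d) → ℝ}

theorem hasLineDerivAt (hf : RapidJet T f) (v z : ℝ × EuclideanSpace ℝ (Fin d)) :
    HasLineDerivAt ℝ f (dirDeriv v f z) z v :=
  hf.smooth.hasLineDerivAt_dirDeriv v z

theorem hasLineDerivAt₂ (hf : RapidJet T f) (v w z : ℝ × EuclideanSpace ℝ (Fin d)) :
    HasLineDerivAt ℝ (dirDeriv w f) (dirDeriv v (dirDeriv w f) z) z v :=
  (hf.smooth.dirDeriv w).hasLineDerivAt_dirDeriv v z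

end RapidJet

/-- The system solved by the real part `a` and the imaginary part `b` of a rapidly decreasing
solution `u = a + i b` of `i ∂_t u = Δu + λ |u|^{2σ} u`. -/
structure IsRealNLS (σ lam T : ℝ) (a b : ℝ × EuclideanSpace ℝ (Fin d) → ℝ) : Prop where
  left : RapidJet T a
  right : RapidJet T b
  dt_left : ∀ t ∈ Set.Icc (0 : ℝ) T, ∀ x, dt a (t, x)
    = (∑ k, dx k (dx k b) (t, x)) + lam * ((a (t, x) ^ 2 + b (t, x) ^ 2) ^ σ * b (t, x))
  dt_right : ∀ t ∈ Set.Icc (0 : ℝ) T, ∀ x, dt b (t, x)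
    = -((∑ k, dx k (dx k a) (t, x)) + lam * ((a (t, x) ^ 2 + b (t, x) ^ 2) ^ σ * a (t, x)))

theorem sum_cross_terms_eq_zero {ι : Type*} [Fintype ι] (x p q : ι → ℝ) (P Q : ι → ι → ℝ)
    (hP : ∀ j k, P j k = P k j) (hQ : ∀ j k, Q j k = Q k j) :
    ∑ k, (x k * (2 * ∑ j, (P k j * p j + Q k j * q j))
      - 2 * ((∑ j, x j * P k j) * p k + (∑ j, x j * Q k j) * q k)) = 0 := by
  have h : ∑ k, 2 * ((∑ j, x j * P k j) * p k + (∑ j, x j * Q k j) * q k)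
      = ∑ k, ∑ j, 2 * (x j * (P k j * p k + Q k j * q k)) := by
    simp only [Finset.sum_mul, Finset.mul_sum, ← Finset.sum_add_distrib]
    exact Finset.sum_congr rfl fun k _ => Finset.sum_congr rfl fun j _ => by ring
  rw [Finset.sum_sub_distrib, h, Finset.sum_comm, sub_eq_zero]
  simp only [Finset.mul_sum]
  refine Finset.sum_congr rfl fun k _ => Finset.sum_congr rfl fun j _ => ?_
  rw [hP k j, hQ k j]
  ring

theorem sum_flux_terms (K A B w a b s r : ℝ) (u v m q p p' : Fin d → ℝ) :
    ∑ k, (K + (s * v k - r * u k + m k) - w * (a * u k + b * v k)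
      - 2 * (q k + A * p k + B * p' k) - d * (q k + a * p k + b * p' k))
    = d * K + (s * ∑ k, v k - r * ∑ k, u k + ∑ k, m k) - w * (a * ∑ k, u k + b * ∑ k, v k)
      - 2 * (∑ k, q k + A * ∑ k, p k + B * ∑ k, p' k)
      - d * (∑ k, q k + a * ∑ k, p k + b * ∑ k, p' k) := by
  simp only [Finset.sum_add_distrib, Finset.sum_sub_distrib, ← Finset.mul_sum, Finset.sum_const,
    Finset.card_univ, Fintype.card_fin, nsmul_eq_mul]

namespace IsRealNLS

variable {σ lam T : ℝ} {a b : ℝ × EuclideanSpace ℝ (Fin d) → ℝ}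

theorem continuous_rpow (h : IsRealNLS σ lam T a b) {p : ℝ} (hp : 0 ≤ p) :
    Continuous fun z => (a z ^ 2 + b z ^ 2) ^ p := by
  have ha := h.left.self.continuous
  have hb := h.right.self.continuous
  exact Continuous.rpow_const (by fun_prop) fun _ => .inr hp

theorem rapidDecay_rpow_mul (h : IsRealNLS σ lam T a b) {p : ℝ} (hp : 0 ≤ p)
    {f : ℝ × EuclideanSpace ℝ (Fin d) → ℝ} (hf : RapidDecay T f) :
    RapidDecay T fun z => (a z ^ 2 + b z ^ 2) ^ p * f z := by
  obtain ⟨A, hA⟩ := h.left.self.bounded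
  obtain ⟨B, hB⟩ := h.right.self.bounded
  refine RapidDecay.bounded_mul (h.continuous_rpow hp) ⟨(A ^ 2 + B ^ 2) ^ p, fun t ht x => ?_⟩ hf
  rw [Real.norm_of_nonneg (by positivity)]
  refine Real.rpow_le_rpow (by positivity) (add_le_add ?_ ?_) hp
  · exact sq_le_sq' (neg_le_of_abs_le (hA t ht x)) (le_of_abs_le (hA t ht x))
  · exact sq_le_sq' (neg_le_of_abs_le (hB t ht x)) (le_of_abs_le (hB t ht x))

theorem rpow_add_one_eq (a b : ℝ) (hσ : 0 ≤ σ) :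
    (a ^ 2 + b ^ 2) ^ (σ + 1) = (a ^ 2 + b ^ 2) ^ σ * (a * a + b * b) := by
  rw [Real.rpow_add_one' (by positivity) (by positivity)]
  ring

theorem rapidDecay_rpow_add_one (h : IsRealNLS σ lam T a b) (hσ : 0 ≤ σ) :
    RapidDecay T fun z => (a z ^ 2 + b z ^ 2) ^ (σ + 1) := by
  simp_rw [rpow_add_one_eq _ _ hσ]
  exact h.rapidDecay_rpow_mul hσ ((h.left.self.mul h.left.self).add (h.right.self.mul h.right.self))

theorem hasLineDerivAt_rpow_add_one (h : IsRealNLS σ lam T a b) (hσ : 0 ≤ σ)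
    (v z : ℝ × EuclideanSpace ℝ (Fin d)) :
    HasLineDerivAt ℝ (fun z => (a z ^ 2 + b z ^ 2) ^ (σ + 1))
      (2 * (σ + 1) * ((a z ^ 2 + b z ^ 2) ^ σ * (a z * dirDeriv v a z + b z * dirDeriv v b z)))
      z v := by
  have ha := h.left.hasLineDerivAt v z
  have hb := h.right.hasLineDerivAt v z
  have h := ((ha.fun_mul ha).fun_add (hb.fun_mul hb)).rpow_const (p := σ + 1) (by linarith)
  simp only [← sq, add_sub_cancel_right] at h
  convert h using 1
  ring

theorem hasDerivAt_variance (h : IsRealNLS σ lam T a b) {t : ℝ} (ht : t ∈ Set.Ioo (0 : ℝ) T) :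
    HasDerivAt (fun s => ∫ x, ‖x‖ ^ 2 * (a (s, x) * a (s, x) + b (s, x) * b (s, x)))
      (∫ x, 4 * ∑ k, x k * (b (t, x) * dx k a (t, x) - a (t, x) * dx k b (t, x))) t := by
  have ha := h.left
  have hb := h.right
  refine RapidDecay.hasDerivAt_integral_of_balance
    (e := fun z => ‖z.2‖ ^ 2 * (a z * a z + b z * b z))
    (e' := fun z => ‖z.2‖ ^ 2 * (2 * (a z * dt a z + b z * dt b z)))
    (r := fun z => 4 * ∑ k, z.2 k * (b z * dx k a z - a z * dx k b z))
    (J := fun k z => ‖z.2‖ ^ 2 * (2 * (a z * dx k b z - b z * dx k a z)))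
    (J' := fun k z => z.2 k * (4 * (a z * dx k b z - b z * dx k a z))
      + ‖z.2‖ ^ 2 * (2 * (a z * dx k (dx k b) z - b z * dx k (dx k a) z)))
    ?_ ?_ ?_ (fun k => ?_) (fun k => ?_) (fun z => ?_) (fun k z => ?_) (fun t ht x => ?_) ht
  · exact ((ha.self.mul ha.self).add (hb.self.mul hb.self)).norm_sq_mul
  · exact (((ha.self.mul ha.dt).add (hb.self.mul hb.dt)).const_mul 2).norm_sq_mul
  · exact RapidDecay.const_mul 4 (.sum fun k =>
      ((hb.self.mul (ha.dx k)).sub (ha.self.mul (hb.dx k))).coord_mul k)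
  · exact (((ha.self.mul (hb.dx k)).sub (hb.self.mul (ha.dx k))).const_mul 2).norm_sq_mul
  · exact ((((ha.self.mul (hb.dx k)).sub (hb.self.mul (ha.dx k))).const_mul 4).coord_mul k).add
      (((ha.self.mul (hb.dx_dx k k)).sub (hb.self.mul (ha.dx_dx k k))).const_mul 2).norm_sq_mul
  · have hat := ha.hasLineDerivAt timeDir z
    have hbt := hb.hasLineDerivAt timeDir z
    convert (HasLineDerivAt.norm_sq_snd z timeDir).fun_mul
      ((hat.fun_mul hat).fun_add (hbt.fun_mul hbt)) using 1
    simp only [timeDir, PiLp.zero_apply, mul_zero, Finset.sum_const_zero]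
    ring
  · have hak := ha.hasLineDerivAt (spaceDir k) z
    have hbk := hb.hasLineDerivAt (spaceDir k) z
    have hakk := ha.hasLineDerivAt₂ (spaceDir k) (spaceDir k) z
    have hbkk := hb.hasLineDerivAt₂ (spaceDir k) (spaceDir k) z
    convert (HasLineDerivAt.norm_sq_snd z (spaceDir k)).fun_mul
      (((hak.fun_mul hbkk).fun_sub (hbk.fun_mul hakk)).fun_const_mul 2) using 1
    simp [spaceDir, PiLp.single_apply]
    ring
  · simp only [h.dt_left t ht x, h.dt_right t ht x]
    rw [Finset.mul_sum, ← Finset.sum_add_distrib]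
    have hsum : ∑ k, (4 * (x k * (b (t, x) * dx k a (t, x) - a (t, x) * dx k b (t, x)))
        + (x k * (4 * (a (t, x) * dx k b (t, x) - b (t, x) * dx k a (t, x)))
          + ‖x‖ ^ 2 * (2 * (a (t, x) * dx k (dx k b) (t, x) - b (t, x) * dx k (dx k a) (t, x)))))
        = ‖x‖ ^ 2 * (2 * (a (t, x) * ∑ k, dx k (dx k b) (t, x)
          - b (t, x) * ∑ k, dx k (dx k a) (t, x))) := by
      simp only [Finset.mul_sum, ← Finset.sum_sub_distrib]
      exact Finset.sum_congr rfl fun k _ => by ring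
    rw [hsum]
    ring

theorem hasDerivAt_energy (h : IsRealNLS σ lam T a b) (hσ : 0 ≤ σ) {t : ℝ}
    (ht : t ∈ Set.Ioo (0 : ℝ) T) :
    HasDerivAt (fun s => ∫ x, ((1 / 2) * (∑ k, (dx k a (s, x) * dx k a (s, x)
        + dx k b (s, x) * dx k b (s, x)))
      - (lam / (2 * σ + 2)) * (a (s, x) ^ 2 + b (s, x) ^ 2) ^ (σ + 1))) 0 t := by
  have ha := h.left
  have hb := h.right
  have key := RapidDecay.hasDerivAt_integral_of_balance (T := T) (t := t)
    (e := fun z => (1 / 2) * (∑ k, (dx k a z * dx k a z + dx k b z * dx k b z))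
      - (lam / (2 * σ + 2)) * (a z ^ 2 + b z ^ 2) ^ (σ + 1))
    (e' := fun z => (∑ k, (dx k a z * dx k (dt a) z + dx k b z * dx k (dt b) z))
      - lam * ((a z ^ 2 + b z ^ 2) ^ σ * (a z * dt a z + b z * dt b z)))
    (r := fun _ => 0)
    (J := fun k z => dx k a z * dt a z + dx k b z * dt b z)
    (J' := fun k z => (dx k (dx k a) z * dt a z + dx k a z * dx k (dt a) z)
      + (dx k (dx k b) z * dt b z + dx k b z * dx k (dt b) z))
    ?_ ?_ .zero (fun k => ?_) (fun k => ?_) (fun z => ?_) (fun k z => ?_) (fun t ht x => ?_) ht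
  · simpa using key
  · exact (RapidDecay.const_mul _ (.sum fun k => ((ha.dx k).mul (ha.dx k)).add
      ((hb.dx k).mul (hb.dx k)))).sub ((h.rapidDecay_rpow_add_one hσ).const_mul _)
  · exact (RapidDecay.sum fun k => ((ha.dx k).mul (ha.dx_dt k)).add
      ((hb.dx k).mul (hb.dx_dt k))).sub ((h.rapidDecay_rpow_mul hσ
        ((ha.self.mul ha.dt).add (hb.self.mul hb.dt))).const_mul _)
  · exact ((ha.dx k).mul ha.dt).add ((hb.dx k).mul hb.dt)
  · exact (((ha.dx_dx k k).mul ha.dt).add ((ha.dx k).mul (ha.dx_dt k))).add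
      (((hb.dx_dx k k).mul hb.dt).add ((hb.dx k).mul (hb.dx_dt k)))
  · have hat k := ha.hasLineDerivAt₂ timeDir (spaceDir k) z
    have hbt k := hb.hasLineDerivAt₂ timeDir (spaceDir k) z
    convert ((HasLineDerivAt.fun_sum (s := Finset.univ) fun k =>
      ((hat k).fun_mul (hat k)).fun_add ((hbt k).fun_mul (hbt k))).fun_const_mul (1 / 2)).fun_sub
      ((h.hasLineDerivAt_rpow_add_one hσ timeDir z).fun_const_mul (lam / (2 * σ + 2))) using 1
    congr 1
    · rw [Finset.mul_sum]
      refine Finset.sum_congr rfl fun k _ => ?_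
      rw [ha.smooth.dirDeriv_comm timeDir, hb.smooth.dirDeriv_comm timeDir]
      ring
    · have : 2 * σ + 2 ≠ 0 := by positivity
      field_simp
  · exact ((ha.hasLineDerivAt₂ (spaceDir k) (spaceDir k) z).fun_mul
      (ha.hasLineDerivAt₂ (spaceDir k) timeDir z)).fun_add
      ((hb.hasLineDerivAt₂ (spaceDir k) (spaceDir k) z).fun_mul
      (hb.hasLineDerivAt₂ (spaceDir k) timeDir z))
  · have hsum : ∑ k, ((dx k (dx k a) (t, x) * dt a (t, x) + dx k a (t, x) * dx k (dt a) (t, x))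
        + (dx k (dx k b) (t, x) * dt b (t, x) + dx k b (t, x) * dx k (dt b) (t, x)))
        = ∑ k, (dx k a (t, x) * dx k (dt a) (t, x) + dx k b (t, x) * dx k (dt b) (t, x))
          + ((∑ k, dx k (dx k a) (t, x)) * dt a (t, x)
            + (∑ k, dx k (dx k b) (t, x)) * dt b (t, x)) := by
      simp only [Finset.sum_mul, ← Finset.sum_add_distrib]
      exact Finset.sum_congr rfl fun k _ => by ring
    rw [hsum]
    simp only [h.dt_left t ht x, h.dt_right t ht x]
    ring

theorem hasDerivAt_momentum (h : IsRealNLS σ lam T a b) (hσ : 0 ≤ σ) {t : ℝ}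
    (ht : t ∈ Set.Ioo (0 : ℝ) T) :
    HasDerivAt (fun s => ∫ x, ∑ k, x k * (b (s, x) * dx k a (s, x) - a (s, x) * dx k b (s, x)))
      (∫ x, (2 * (∑ k, (dx k a (t, x) * dx k a (t, x) + dx k b (t, x) * dx k b (t, x)))
        - (lam * d * σ / (σ + 1)) * (a (t, x) ^ 2 + b (t, x) ^ 2) ^ (σ + 1))) t := by
  have ha := h.left
  have hb := h.right
  have hS : RapidDecay T fun z => b z * dt a z - a z * dt b z :=
    (hb.self.mul ha.dt).sub (ha.self.mul hb.dt)
  have hQ : RapidDecay T fun z => ∑ j, (dx j a z * dx j a z + dx j b z * dx j b z) :=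
    .sum fun j => ((ha.dx j).mul (ha.dx j)).add ((hb.dx j).mul (hb.dx j))
  have hP := h.rapidDecay_rpow_add_one hσ
  have hA : RapidDecay T fun z => ∑ j, z.2 j * dx j a z := .sum fun j => (ha.dx j).coord_mul j
  have hB : RapidDecay T fun z => ∑ j, z.2 j * dx j b z := .sum fun j => (hb.dx j).coord_mul j
  have hA' k : RapidDecay T fun z => dx k a z + ∑ j, z.2 j * dx k (dx j a) z :=
    (ha.dx k).add (.sum fun j => (ha.dx_dx k j).coord_mul j)
  have hB' k : RapidDecay T fun z => dx k b z + ∑ j, z.2 j * dx k (dx j b) z :=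
    (hb.dx k).add (.sum fun j => (hb.dx_dx k j).coord_mul j)
  have hdA k z : HasLineDerivAt ℝ (fun z => ∑ j, z.2 j * dx j a z)
      (dx k a z + ∑ j, z.2 j * dx k (dx j a) z) z (spaceDir k) := by
    convert HasLineDerivAt.fun_sum (s := Finset.univ) fun j =>
      (HasLineDerivAt.coord z (spaceDir k) j).fun_mul
        (ha.hasLineDerivAt₂ (spaceDir k) (spaceDir j) z) using 1
    simp [spaceDir, PiLp.single_apply, Finset.sum_add_distrib]
  have hdB k z : HasLineDerivAt ℝ (fun z => ∑ j, z.2 j * dx j b z)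
      (dx k b z + ∑ j, z.2 j * dx k (dx j b) z) z (spaceDir k) := by
    convert HasLineDerivAt.fun_sum (s := Finset.univ) fun j =>
      (HasLineDerivAt.coord z (spaceDir k) j).fun_mul
        (hb.hasLineDerivAt₂ (spaceDir k) (spaceDir j) z) using 1
    simp [spaceDir, PiLp.single_apply, Finset.sum_add_distrib]
  refine RapidDecay.hasDerivAt_integral_of_balance
    (e := fun z => ∑ k, z.2 k * (b z * dx k a z - a z * dx k b z))
    (e' := fun z => ∑ k, z.2 k * ((dt b z * dx k a z - dt a z * dx k b z)
      + (b z * dx k (dt a) z - a z * dx k (dt b) z)))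
    (r := fun z => 2 * (∑ k, (dx k a z * dx k a z + dx k b z * dx k b z))
        - (lam * d * σ / (σ + 1)) * (a z ^ 2 + b z ^ 2) ^ (σ + 1))
    (J := fun k z => z.2 k * ((b z * dt a z - a z * dt b z)
        + (∑ j, (dx j a z * dx j a z + dx j b z * dx j b z))
        - (lam / (σ + 1)) * (a z ^ 2 + b z ^ 2) ^ (σ + 1))
      - 2 * ((∑ j, z.2 j * dx j a z) * dx k a z + (∑ j, z.2 j * dx j b z) * dx k b z)
      - d * (a z * dx k a z + b z * dx k b z))
    (J' := fun k z => ((b z * dt a z - a z * dt b z)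
        + (∑ j, (dx j a z * dx j a z + dx j b z * dx j b z))
        - (lam / (σ + 1)) * (a z ^ 2 + b z ^ 2) ^ (σ + 1))
      + z.2 k * ((dx k b z * dt a z + b z * dx k (dt a) z - (dx k a z * dt b z + a z * dx k (dt b) z))
        + 2 * (∑ j, (dx k (dx j a) z * dx j a z + dx k (dx j b) z * dx j b z))
        - 2 * lam * ((a z ^ 2 + b z ^ 2) ^ σ * (a z * dx k a z + b z * dx k b z)))
      - 2 * ((dx k a z + ∑ j, z.2 j * dx k (dx j a) z) * dx k a z
        + (∑ j, z.2 j * dx j a z) * dx k (dx k a) z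
        + ((dx k b z + ∑ j, z.2 j * dx k (dx j b) z) * dx k b z
        + (∑ j, z.2 j * dx j b z) * dx k (dx k b) z))
      - d * (dx k a z * dx k a z + a z * dx k (dx k a) z
        + (dx k b z * dx k b z + b z * dx k (dx k b) z)))
    ?_ ?_ ?_ (fun k => ?_) (fun k => ?_) (fun z => ?_) (fun k z => ?_) (fun t ht x => ?_) ht
  · exact .sum fun k => ((hb.self.mul (ha.dx k)).sub (ha.self.mul (hb.dx k))).coord_mul k
  · exact .sum fun k => (((hb.dt.mul (ha.dx k)).sub (ha.dt.mul (hb.dx k))).add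
      ((hb.self.mul (ha.dx_dt k)).sub (ha.self.mul (hb.dx_dt k)))).coord_mul k
  · exact (hQ.const_mul 2).sub (hP.const_mul _)
  · exact ((((hS.add hQ).sub (hP.const_mul _)).coord_mul k).sub
      (((hA.mul (ha.dx k)).add (hB.mul (hb.dx k))).const_mul 2)).sub
      (((ha.self.mul (ha.dx k)).add (hb.self.mul (hb.dx k))).const_mul _)
  · refine ((((hS.add hQ).sub (hP.const_mul _)).add ?_).sub
      (((((hA' k).mul (ha.dx k)).add (hA.mul (ha.dx_dx k k))).add
        (((hB' k).mul (hb.dx k)).add (hB.mul (hb.dx_dx k k)))).const_mul 2)).sub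
      (((((ha.dx k).mul (ha.dx k)).add (ha.self.mul (ha.dx_dx k k))).add
        (((hb.dx k).mul (hb.dx k)).add (hb.self.mul (hb.dx_dx k k)))).const_mul _)
    exact (((((((hb.dx k).mul ha.dt).add (hb.self.mul (ha.dx_dt k))).sub
      (((ha.dx k).mul hb.dt).add (ha.self.mul (hb.dx_dt k)))).add
      (RapidDecay.const_mul 2 (.sum fun j => ((ha.dx_dx k j).mul (ha.dx j)).add
        ((hb.dx_dx k j).mul (hb.dx j)))))).sub
      ((h.rapidDecay_rpow_mul hσ ((ha.self.mul (ha.dx k)).add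
        (hb.self.mul (hb.dx k)))).const_mul _)).coord_mul k
  · have hat := ha.hasLineDerivAt timeDir z
    have hbt := hb.hasLineDerivAt timeDir z
    convert HasLineDerivAt.fun_sum (s := Finset.univ) fun k =>
      (HasLineDerivAt.coord z timeDir k).fun_mul
      ((hbt.fun_mul (ha.hasLineDerivAt₂ timeDir (spaceDir k) z)).fun_sub
        (hat.fun_mul (hb.hasLineDerivAt₂ timeDir (spaceDir k) z))) using 1
    refine Finset.sum_congr rfl fun k _ => ?_
    rw [ha.smooth.dirDeriv_comm timeDir, hb.smooth.dirDeriv_comm timeDir]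
    simp only [timeDir, PiLp.zero_apply]
    ring
  · have hak := ha.hasLineDerivAt (spaceDir k) z
    have hbk := hb.hasLineDerivAt (spaceDir k) z
    have ha₂ j := ha.hasLineDerivAt₂ (spaceDir k) (spaceDir j) z
    have hb₂ j := hb.hasLineDerivAt₂ (spaceDir k) (spaceDir j) z
    have hdS := (hbk.fun_mul (ha.hasLineDerivAt₂ (spaceDir k) timeDir z)).fun_sub
      (hak.fun_mul (hb.hasLineDerivAt₂ (spaceDir k) timeDir z))
    have hdQ := HasLineDerivAt.fun_sum (s := Finset.univ) fun j =>
      ((ha₂ j).fun_mul (ha₂ j)).fun_add ((hb₂ j).fun_mul (hb₂ j))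
    have hdP := (h.hasLineDerivAt_rpow_add_one hσ (spaceDir k) z).fun_const_mul (lam / (σ + 1))
    convert (((HasLineDerivAt.coord z (spaceDir k) k).fun_mul
      ((hdS.fun_add hdQ).fun_sub hdP)).fun_sub
      ((((hdA k z).fun_mul (ha₂ k)).fun_add ((hdB k z).fun_mul (hb₂ k))).fun_const_mul 2)).fun_sub
      (((hak.fun_mul (ha₂ k)).fun_add (hbk.fun_mul (hb₂ k))).fun_const_mul d) using 1
    have hQ' : ∑ j, (dx k (dx j a) z * dx j a z + dx j a z * dx k (dx j a) z
        + (dx k (dx j b) z * dx j b z + dx j b z * dx k (dx j b) z))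
        = 2 * ∑ j, (dx k (dx j a) z * dx j a z + dx k (dx j b) z * dx j b z) := by
      rw [Finset.mul_sum]
      exact Finset.sum_congr rfl fun j _ => by ring
    have hP' : lam / (σ + 1) * (2 * (σ + 1) * ((a z ^ 2 + b z ^ 2) ^ σ
        * (a z * dx k a z + b z * dx k b z)))
        = 2 * lam * ((a z ^ 2 + b z ^ 2) ^ σ * (a z * dx k a z + b z * dx k b z)) := by
      have : σ + 1 ≠ 0 := by positivity
      field_simp
    rw [hQ', hP']
    simp only [spaceDir, PiLp.single_apply, if_true]
    ring
  · have hcross := sum_cross_terms_eq_zero x (fun k => dx k a (t, x)) (fun k => dx k b (t, x))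
      (fun j k => dx j (dx k a) (t, x)) (fun j k => dx j (dx k b) (t, x))
      (fun j k => ha.smooth.dirDeriv_comm _ _ _) (fun j k => hb.smooth.dirDeriv_comm _ _ _)
    have hflux := sum_flux_terms (d := d)
      ((b (t, x) * dt a (t, x) - a (t, x) * dt b (t, x))
        + (∑ j, (dx j a (t, x) * dx j a (t, x) + dx j b (t, x) * dx j b (t, x)))
        - (lam / (σ + 1)) * (a (t, x) ^ 2 + b (t, x) ^ 2) ^ (σ + 1))
      (∑ j, x j * dx j a (t, x)) (∑ j, x j * dx j b (t, x))
      (2 * lam * (a (t, x) ^ 2 + b (t, x) ^ 2) ^ σ) (a (t, x)) (b (t, x)) (dt a (t, x))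
      (dt b (t, x))
      (fun k => x k * dx k a (t, x)) (fun k => x k * dx k b (t, x))
      (fun k => x k * (b (t, x) * dx k (dt a) (t, x) - a (t, x) * dx k (dt b) (t, x)))
      (fun k => dx k a (t, x) * dx k a (t, x) + dx k b (t, x) * dx k b (t, x))
      (fun k => dx k (dx k a) (t, x)) (fun k => dx k (dx k b) (t, x))
    have hleft : ∑ k, x k * ((dt b (t, x) * dx k a (t, x) - dt a (t, x) * dx k b (t, x))
        + (b (t, x) * dx k (dt a) (t, x) - a (t, x) * dx k (dt b) (t, x)))
        = dt b (t, x) * (∑ k, x k * dx k a (t, x)) - dt a (t, x) * (∑ k, x k * dx k b (t, x))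
          + ∑ k, x k * (b (t, x) * dx k (dt a) (t, x) - a (t, x) * dx k (dt b) (t, x)) := by
      rw [Finset.mul_sum, Finset.mul_sum, ← Finset.sum_sub_distrib, ← Finset.sum_add_distrib]
      exact Finset.sum_congr rfl fun k _ => by ring
    have hσ' : σ + 1 ≠ 0 := by positivity
    have hright := congrArg₂ (· + ·) hflux hcross
    rw [← Finset.sum_add_distrib] at hright
    rw [hleft]
    refine Eq.trans ?_ (congrArg _ (hright.symm.trans (Finset.sum_congr rfl fun k _ => ?_)))
    · rw [h.dt_left t ht x, h.dt_right t ht x, rpow_add_one_eq _ _ hσ]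
      field_simp
      ring
    · ring

end IsRealNLS
theorem dx_eq_pd (g : ℝ × EuclideanSpace ℝ (Fin d) → ℂ) (hg : ContDiff ℝ (⊤ : ℕ∞) g) (k : Fin d)
    (t : ℝ) (x : EuclideanSpace ℝ (Fin d)) : dx k g (t, x) = pd (fun y => g (t, y)) k x := by
  have h := (hg.differentiable (by simp) (t, x)).hasFDerivAt.comp x (hasFDerivAt_prodMk_right t x)
  exact (congrArg (fun A => A (EuclideanSpace.single k 1)) h.fderiv).symm

theorem dx_dx_eq_pd2 (g : ℝ × EuclideanSpace ℝ (Fin d) → ℂ) (hg : ContDiff ℝ (⊤ : ℕ∞) g)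
    (j k : Fin d) (t : ℝ) (x : EuclideanSpace ℝ (Fin d)) :
    dx j (dx k g) (t, x) = pd2 (fun y => g (t, y)) j k x := by
  rw [dx_eq_pd _ (hg.dirDeriv _), pd2, pd]
  simp only [dx_eq_pd g hg, pd]

theorem dt_eq_deriv (g : ℝ × EuclideanSpace ℝ (Fin d) → ℂ) (hg : ContDiff ℝ (⊤ : ℕ∞) g)
    (t : ℝ) (x : EuclideanSpace ℝ (Fin d)) : dt g (t, x) = deriv (fun s => g (s, x)) t := by
  have h := (hg.differentiable (by simp) (t, x)).hasFDerivAt.comp t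
    (hasFDerivAt_prodMk_left (𝕜 := ℝ) t x)
  exact h.hasDerivAt.deriv.symm

section Decay

variable {T : ℝ} {g : ℝ × EuclideanSpace ℝ (Fin d) → ℂ}

theorem rapidDecay_of_le_iteratedFDeriv
    (h : ∀ n k : ℕ, ∃ C : ℝ, ∀ t ∈ Set.Icc (0 : ℝ) T, ∀ x,
      (1 + ‖x‖) ^ k * ‖iteratedFDeriv ℝ n (fun y => g (t, y)) x‖ ≤ C)
    {f : ℝ × EuclideanSpace ℝ (Fin d) → ℂ} (hf : Continuous f) (n : ℕ)
    (hfg : ∀ t x, ‖f (t, x)‖ ≤ ‖iteratedFDeriv ℝ n (fun y => g (t, y)) x‖) : RapidDecay T f := by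
  refine ⟨hf, fun k => ?_⟩
  obtain ⟨C, hC⟩ := h n k
  exact ⟨C, fun t ht x =>
    (mul_le_mul_of_nonneg_left (hfg t x) (by positivity)).trans (hC t ht x)⟩

theorem norm_pd_le (v : EuclideanSpace ℝ (Fin d) → ℂ) (k : Fin d)
    (x : EuclideanSpace ℝ (Fin d)) : ‖pd v k x‖ ≤ ‖iteratedFDeriv ℝ 1 v x‖ := by
  have h := (iteratedFDeriv ℝ 1 v x).le_opNorm fun _ => EuclideanSpace.single k (1 : ℝ)
  simpa [iteratedFDeriv_one_apply, pd] using h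

theorem norm_pd2_le {v : EuclideanSpace ℝ (Fin d) → ℂ} (hv : ContDiff ℝ (⊤ : ℕ∞) v) (j k : Fin d)
    (x : EuclideanSpace ℝ (Fin d)) : ‖pd2 v j k x‖ ≤ ‖iteratedFDeriv ℝ 2 v x‖ := by
  have h := (iteratedFDeriv ℝ 2 v x).le_opNorm
    ![EuclideanSpace.single j (1 : ℝ), EuclideanSpace.single k (1 : ℝ)]
  have hd : DifferentiableAt ℝ (fderiv ℝ v) x :=
    (hv.fderiv_right (m := (⊤ : ℕ∞)) (by simp)).differentiable (by simp) x
  rw [pd2, fderiv_clm_apply hd (differentiableAt_const _)]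
  simpa [iteratedFDeriv_two_apply, Fin.prod_univ_two] using h

theorem RapidlyDecreasingOn.rapidJet {u : ℝ × EuclideanSpace ℝ (Fin d) → ℂ}
    (h : RapidlyDecreasingOn T u) (hu : ContDiff ℝ (⊤ : ℕ∞) u) : RapidJet T u := by
  have h₀ : ∀ n k : ℕ, ∃ C : ℝ, ∀ t ∈ Set.Icc (0 : ℝ) T, ∀ x,
      (1 + ‖x‖) ^ k * ‖iteratedFDeriv ℝ n (fun y => u (t, y)) x‖ ≤ C := fun n k =>
    (h n k).imp fun C hC t ht x => (hC t ht x).1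
  have h₁ : ∀ n k : ℕ, ∃ C : ℝ, ∀ t ∈ Set.Icc (0 : ℝ) T, ∀ x,
      (1 + ‖x‖) ^ k * ‖iteratedFDeriv ℝ n (fun y => dt u (t, y)) x‖ ≤ C := fun n k =>
    (h n k).imp fun C hC t ht x => by simpa only [dt_eq_deriv u hu] using (hC t ht x).2
  have hut := hu.dirDeriv timeDir
  refine ⟨hu, ?_, ?_, fun k => ?_, fun j k => ?_, fun k => ?_⟩
  · exact rapidDecay_of_le_iteratedFDeriv h₀ hu.continuous 0 fun t x => by simp
  · exact rapidDecay_of_le_iteratedFDeriv h₁ hut.continuous 0 fun t x => by simp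
  · refine rapidDecay_of_le_iteratedFDeriv h₀ (hu.dirDeriv _).continuous 1 fun t x => ?_
    rw [dx_eq_pd u hu]
    exact norm_pd_le _ k x
  · refine rapidDecay_of_le_iteratedFDeriv h₀ ((hu.dirDeriv _).dirDeriv _).continuous 2
      fun t x => ?_
    rw [dx_dx_eq_pd2 u hu]
    exact norm_pd2_le (hu.comp (contDiff_prodMk_right t)) j k x
  · refine rapidDecay_of_le_iteratedFDeriv h₁ (hut.dirDeriv _).continuous 1 fun t x => ?_
    rw [dx_eq_pd _ hut]
    exact norm_pd_le _ k x

end Decay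

section Functionals

variable {σt lam T : ℝ} {u : ℝ × EuclideanSpace ℝ (Fin d) → ℂ}

theorem dirDeriv_re (hu : ContDiff ℝ (⊤ : ℕ∞) u) (v : ℝ × EuclideanSpace ℝ (Fin d)) :
    dirDeriv v (fun z => (u z).re) = fun z => (dirDeriv v u z).re :=
  dirDeriv_clm_comp Complex.reCLM hu v

theorem dirDeriv_im (hu : ContDiff ℝ (⊤ : ℕ∞) u) (v : ℝ × EuclideanSpace ℝ (Fin d)) :
    dirDeriv v (fun z => (u z).im) = fun z => (dirDeriv v u z).im :=
  dirDeriv_clm_comp Complex.imCLM hu v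

theorem norm_sq_eq_re_im (w : ℂ) : ‖w‖ ^ 2 = w.re ^ 2 + w.im ^ 2 := by
  rw [Complex.sq_norm, Complex.normSq_apply]
  ring

theorem norm_rpow_two_mul (w : ℂ) (p : ℝ) : ‖w‖ ^ (2 * p) = (w.re ^ 2 + w.im ^ 2) ^ p := by
  rw [Real.rpow_mul (norm_nonneg w), Real.rpow_two, norm_sq_eq_re_im]

theorem IsNLSSolution.isRealNLS (h : IsNLSSolution σt lam T u) (hj : RapidJet T u) :
    IsRealNLS σt lam T (fun z => (u z).re) (fun z => (u z).im) := by
  have hu := hj.smooth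
  refine ⟨hj.clm_comp Complex.reCLM, hj.clm_comp Complex.imCLM, fun t ht x => ?_, fun t ht x => ?_⟩
  · have h' := congrArg Complex.im (h t ht x)
    simp only [dirDeriv_re hu, dirDeriv_im hu, dirDeriv_im (hu.dirDeriv _)]
    rw [← dt_eq_deriv u hu] at h'
    simp only [lap, ← dx_dx_eq_pd2 u hu, norm_rpow_two_mul] at h'
    simpa [mul_assoc] using h'
  · have h' := congrArg Complex.re (h t ht x)
    simp only [dirDeriv_re hu, dirDeriv_im hu, dirDeriv_re (hu.dirDeriv _)]
    rw [← dt_eq_deriv u hu] at h'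
    simp only [lap, ← dx_dx_eq_pd2 u hu, norm_rpow_two_mul] at h'
    simp [mul_assoc] at h'
    linarith

theorem varV_slice (t : ℝ) : varV (fun y => u (t, y))
    = ∫ x, ‖x‖ ^ 2 * ((u (t, x)).re * (u (t, x)).re + (u (t, x)).im * (u (t, x)).im) := by
  simp only [varV, norm_sq_eq_re_im (u _), ← sq]

theorem momG_slice (hj : RapidJet T u) {t : ℝ} (ht : t ∈ Set.Icc (0 : ℝ) T) :
    momG (fun y => u (t, y)) = ∫ x, ∑ k, x k * ((u (t, x)).im * dx k (fun z => (u z).re) (t, x)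
      - (u (t, x)).re * dx k (fun z => (u z).im) (t, x)) := by
  have hu := hj.smooth
  have hint : RapidDecay T fun z => u z * ∑ k, (z.2 k : ℂ) * (starRingEnd ℂ) (dx k u z) := by
    refine hj.self.mul (.sum fun k => ?_)
    have hk := (hj.dx k).clm_comp (Complex.conjCLE : ℂ →L[ℝ] ℂ)
    refine hk.of_norm_le (Continuous.mul (by fun_prop) hk.continuous) 1 1 fun t _ x => ?_
    rw [norm_mul, one_mul, pow_one]
    gcongr
    · simpa using (PiLp.norm_apply_le x k).trans (by simp)
    · simp
  have him := integral_im (hint.integrable ht)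
  simp only [momG, ← dx_eq_pd u hu]
  refine him.symm.trans (integral_congr_ae (.of_forall fun x => ?_))
  simp only [dirDeriv_re hu, dirDeriv_im hu, Finset.mul_sum]
  simp
  exact Finset.sum_congr rfl fun k _ => by ring

theorem energyH_slice (hσ : 0 ≤ σt) (hj : RapidJet T u)
    (h : IsRealNLS σt lam T (fun z => (u z).re) (fun z => (u z).im)) {t : ℝ}
    (ht : t ∈ Set.Icc (0 : ℝ) T) :
    energyH σt lam (fun y => u (t, y)) = ∫ x, ((1 / 2) * (∑ k,
        (dx k (fun z => (u z).re) (t, x) * dx k (fun z => (u z).re) (t, x)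
        + dx k (fun z => (u z).im) (t, x) * dx k (fun z => (u z).im) (t, x)))
      - (lam / (2 * σt + 2)) * ((u (t, x)).re ^ 2 + (u (t, x)).im ^ 2) ^ (σt + 1)) := by
  have hu := hj.smooth
  have hQ : RapidDecay T fun z => ∑ k, (dx k (fun z => (u z).re) z * dx k (fun z => (u z).re) z
      + dx k (fun z => (u z).im) z * dx k (fun z => (u z).im) z) :=
    .sum fun k => ((h.left.dx k).mul (h.left.dx k)).add ((h.right.dx k).mul (h.right.dx k))
  rw [integral_sub ((hQ.integrable ht).const_mul _)
    (((h.rapidDecay_rpow_add_one hσ).integrable ht).const_mul _), integral_const_mul,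
    integral_const_mul, energyH]
  simp only [← dx_eq_pd u hu, dirDeriv_re hu, dirDeriv_im hu, norm_sq_eq_re_im, ← sq,
    ← norm_rpow_two_mul, mul_add, mul_one]

end Functionals

theorem le_of_hasDerivAt_nonneg {T : ℝ} {f f' : ℝ → ℝ} (hf : ContinuousOn f (Set.Icc 0 T))
    (hf' : ∀ s ∈ Set.Ioo 0 T, HasDerivAt f (f' s) s) (h : ∀ s ∈ Set.Ioo 0 T, 0 ≤ f' s) {t : ℝ}
    (ht : t ∈ Set.Icc 0 T) : f 0 ≤ f t := by
  refine monotoneOn_of_deriv_nonneg (convex_Icc 0 T) hf ?_ ?_ (Set.left_mem_Icc.2 (ht.1.trans ht.2))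
    ht ht.1
  · rw [interior_Icc]
    exact fun s hs => (hf' s hs).differentiableAt.differentiableWithinAt
  · rw [interior_Icc]
    exact fun s hs => (hf' s hs).deriv ▸ h s hs

/-- The deterministic variance inequality (5.4) used in the proof of Proposition 5.2,
valid in the critical and supercritical regime `σ̃ ≥ 2/d`:
`V(u(t)) ≤ V(u(0)) + 4t G(u(0)) + 8t² H_{σ̃,λ}(u(0))`. -/
theorem variance_inequality_NLS
    (hd : 1 ≤ d) {σt lam : ℝ} (hσt : 2 / (d : ℝ) ≤ σt) (hlam : 0 ≤ lam)
    {T : ℝ} (hT : 0 < T)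
    (u : ℝ × EuclideanSpace ℝ (Fin d) → ℂ)
    (hu_smooth : ContDiff ℝ (⊤ : ℕ∞) u)
    (hu_decay : RapidlyDecreasingOn T u)
    (hu_eq : IsNLSSolution σt lam T u) :
    ∀ t ∈ Set.Icc (0 : ℝ) T,
      varV (fun y => u (t, y))
        ≤ varV (fun y => u (0, y)) + 4 * t * momG (fun y => u (0, y))
          + 8 * t ^ 2 * energyH σt lam (fun y => u (0, y)) := by
  have hd' : (0 : ℝ) < d := by exact_mod_cast hd
  have hσ : 0 ≤ σt := le_trans (by positivity) hσt
  have hdσ : 2 ≤ d * σt := by rwa [div_le_iff₀' hd'] at hσt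
  have h0 : (0 : ℝ) ∈ Set.Icc 0 T := Set.left_mem_Icc.2 hT.le
  have hj := hu_decay.rapidJet hu_smooth
  have h := hu_eq.isRealNLS hj
  set V : ℝ → ℝ := fun s => ∫ x, ‖x‖ ^ 2 * ((u (s, x)).re * (u (s, x)).re
    + (u (s, x)).im * (u (s, x)).im) with hV
  set G : ℝ → ℝ := fun s => ∫ x, ∑ k, x k * ((u (s, x)).im * dx k (fun z => (u z).re) (s, x)
    - (u (s, x)).re * dx k (fun z => (u z).im) (s, x)) with hG
  set H : ℝ → ℝ := fun s => ∫ x, ((1 / 2) * (∑ k,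
        (dx k (fun z => (u z).re) (s, x) * dx k (fun z => (u z).re) (s, x)
        + dx k (fun z => (u z).im) (s, x) * dx k (fun z => (u z).im) (s, x)))
      - (lam / (2 * σt + 2)) * ((u (s, x)).re ^ 2 + (u (s, x)).im ^ 2) ^ (σt + 1)) with hH
  have hVr : RapidDecay T fun z => ‖z.2‖ ^ 2 * ((u z).re * (u z).re + (u z).im * (u z).im) :=
    ((h.left.self.mul h.left.self).add (h.right.self.mul h.right.self)).norm_sq_mul
  have hGr : RapidDecay T fun z => ∑ k, z.2 k * ((u z).im * dx k (fun z => (u z).re) z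
      - (u z).re * dx k (fun z => (u z).im) z) :=
    .sum fun k => ((h.right.self.mul (h.left.dx k)).sub (h.left.self.mul (h.right.dx k))).coord_mul k
  have hQr : RapidDecay T fun z => ∑ k, (dx k (fun z => (u z).re) z * dx k (fun z => (u z).re) z
      + dx k (fun z => (u z).im) z * dx k (fun z => (u z).im) z) :=
    .sum fun k => ((h.left.dx k).mul (h.left.dx k)).add ((h.right.dx k).mul (h.right.dx k))
  have hPr := h.rapidDecay_rpow_add_one hσ
  have hHr := (hQr.const_mul (1 / 2)).sub (hPr.const_mul (lam / (2 * σt + 2)))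
  have hVc : ContinuousOn V (Set.Icc 0 T) := hVr.continuousOn_integral
  have hGc : ContinuousOn G (Set.Icc 0 T) := hGr.continuousOn_integral
  have hHc : ContinuousOn H (Set.Icc 0 T) := hHr.continuousOn_integral
  have hH0 : ∀ s ∈ Set.Icc 0 T, H s ≤ H 0 := fun s hs => neg_le_neg_iff.1 <|
    le_of_hasDerivAt_nonneg hHc.neg (fun r hr => (h.hasDerivAt_energy hσ hr).neg) (by simp) hs
  have hG0 : ∀ s ∈ Set.Icc 0 T, G s ≤ G 0 + 4 * s * H 0 := by
    intro s hs
    have := le_of_hasDerivAt_nonneg (f := fun r => r * (4 * H 0) - G r)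
      (by fun_prop) (fun r hr => ((hasDerivAt_id r).mul_const (4 * H 0)).sub
        (h.hasDerivAt_momentum hσ hr)) (fun r hr => ?_) hs
    · linarith
    · have hr' := Set.Ioo_subset_Icc_self hr
      rw [one_mul, sub_nonneg]
      refine le_trans ?_ (mul_le_mul_of_nonneg_left (hH0 r hr') (by norm_num))
      rw [hH, ← integral_const_mul]
      refine integral_mono (((hQr.const_mul 2).sub (hPr.const_mul _)).integrable hr')
        ((hHr.const_mul 4).integrable hr') fun x => ?_
      have hP : 0 ≤ ((u (r, x)).re ^ 2 + (u (r, x)).im ^ 2) ^ (σt + 1) := by positivity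
      have hc : 4 * (lam / (2 * σt + 2)) ≤ lam * d * σt / (σt + 1) := by
        rw [show 4 * (lam / (2 * σt + 2)) = lam * 2 / (σt + 1) by field_simp; ring, mul_assoc]
        gcongr
      have := mul_le_mul_of_nonneg_right hc hP
      simp only
      linarith
  intro t ht
  rw [varV_slice, varV_slice, momG_slice hj h0, energyH_slice hσ hj h h0]
  change V t ≤ V 0 + 4 * t * G 0 + 8 * t ^ 2 * H 0
  have := le_of_hasDerivAt_nonneg (f := fun s => s * (4 * G 0) + s ^ 2 * (8 * H 0) - V s)
    (by fun_prop) (fun s hs => (((hasDerivAt_id s).mul_const (4 * G 0)).add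
      (((hasDerivAt_id s).pow 2).mul_const (8 * H 0))).sub (h.hasDerivAt_variance hs))
    (fun s hs => ?_) ht
  · linarith
  · rw [integral_const_mul]
    have := hG0 s (Set.Ioo_subset_Icc_self hs)
    simp only [hG, id] at this ⊢
    norm_num
    linarith
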